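/- Let F be a field with char F ∉ {2,7} and let c ∈ F satisfy c^2 + c + 2 = 0. With D_1, D_2, D_3 as in the context, the ideal (zD_3, xD_1, yD_2) of R = F[x,y,z] has radical equal to the maximal ideal (x,y,z); equivalently, the three homogeneous cubics zD_3, xD_1, yD_2 have no common zero in P^2 over an algebraic closure of F, and hence form a regular sequence in R. -/

import Mathlib

open MvPolynomial

noncomputable section

/-- `C₃ = 4x⁴+4y⁴+(3c+9)x²y²+(5c−1)x²z²+(5c−1)y²z²+(15c+25)z⁴`. -/
def C₃ {F : Type*} [Field F] (c : F) : MvPolynomial (Fin 3) F :=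
  4 * X 0 ^ 4 + 4 * X 1 ^ 4 + C (3 * c + 9) * X 0 ^ 2 * X 1 ^ 2 +
    C (5 * c - 1) * X 0 ^ 2 * X 2 ^ 2 + C (5 * c - 1) * X 1 ^ 2 * X 2 ^ 2 +
    C (15 * c + 25) * X 2 ^ 4

/-- `C₁ = (15c+25)x⁴+4y⁴+(5c−1)x²y²+(5c−1)x²z²+(3c+9)y²z²+4z⁴`. -/
def C₁ {F : Type*} [Field F] (c : F) : MvPolynomial (Fin 3) F :=
  C (15 * c + 25) * X 0 ^ 4 + 4 * X 1 ^ 4 + C (5 * c - 1) * X 0 ^ 2 * X 1 ^ 2 +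
    C (5 * c - 1) * X 0 ^ 2 * X 2 ^ 2 + C (3 * c + 9) * X 1 ^ 2 * X 2 ^ 2 +
    4 * X 2 ^ 4

/-- `C₂ = 4x⁴+(15c+25)y⁴+(5c−1)x²y²+(3c+9)x²z²+(5c−1)y²z²+4z⁴`. -/
def C₂ {F : Type*} [Field F] (c : F) : MvPolynomial (Fin 3) F :=
  4 * X 0 ^ 4 + C (15 * c + 25) * X 1 ^ 4 + C (5 * c - 1) * X 0 ^ 2 * X 1 ^ 2 +
    C (3 * c + 9) * X 0 ^ 2 * X 2 ^ 2 + C (5 * c - 1) * X 1 ^ 2 * X 2 ^ 2 +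
    4 * X 2 ^ 4

/-- `D₃ = (15c+21)x²+(15c+21)y²+(2c−10)z²`. -/
def D₃ {F : Type*} [Field F] (c : F) : MvPolynomial (Fin 3) F :=
  C (15 * c + 21) * X 0 ^ 2 + C (15 * c + 21) * X 1 ^ 2 + C (2 * c - 10) * X 2 ^ 2

/-- `D₁ = (2c−10)x²+(15c+21)y²+(15c+21)z²`. -/
def D₁ {F : Type*} [Field F] (c : F) : MvPolynomial (Fin 3) F :=
  C (2 * c - 10) * X 0 ^ 2 + C (15 * c + 21) * X 1 ^ 2 + C (15 * c + 21) * X 2 ^ 2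

/-- `D₂ = (15c+21)x²+(2c−10)y²+(15c+21)z²`. -/
def D₂ {F : Type*} [Field F] (c : F) : MvPolynomial (Fin 3) F :=
  C (15 * c + 21) * X 0 ^ 2 + C (2 * c - 10) * X 1 ^ 2 + C (15 * c + 21) * X 2 ^ 2

/-- `f = xy(x²−y²)C₃`. -/
def kf {F : Type*} [Field F] (c : F) : MvPolynomial (Fin 3) F :=
  X 0 * X 1 * (X 0 ^ 2 - X 1 ^ 2) * C₃ c

/-- `g = yz(y²−z²)C₁`. -/
def kg {F : Type*} [Field F] (c : F) : MvPolynomial (Fin 3) F :=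
  X 1 * X 2 * (X 1 ^ 2 - X 2 ^ 2) * C₁ c

/-- `h = zx(z²−x²)C₂`. -/
def kh {F : Type*} [Field F] (c : F) : MvPolynomial (Fin 3) F :=
  X 2 * X 0 * (X 2 ^ 2 - X 0 ^ 2) * C₂ c

/-- A triple of pairwise coprime elements, the last of which is a non-zero-divisor modulo the
ideal generated by the first two. In a UFD this notion does not depend on the order. -/
structure IsCoprimeRegularTriple {R : Type*} [CommRing R] (f g h : R) : Prop where
  isRelPrime₁₂ : IsRelPrime f g
  isRelPrime₁₃ : IsRelPrime f h
  isRelPrime₂₃ : IsRelPrime g h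
  mem_of_mul_mem : ∀ p, h * p ∈ Ideal.span {f, g} → p ∈ Ideal.span {f, g}

namespace IsCoprimeRegularTriple

section CommRing

variable {R : Type*} [CommRing R] {f g h h' : R}

theorem swap₁₂ (H : IsCoprimeRegularTriple f g h) : IsCoprimeRegularTriple g f h where
  isRelPrime₁₂ := H.isRelPrime₁₂.symm
  isRelPrime₁₃ := H.isRelPrime₂₃
  isRelPrime₂₃ := H.isRelPrime₁₃
  mem_of_mul_mem := by
    rw [Set.pair_comm]
    exact H.mem_of_mul_mem

/-- The last entry may be replaced by any element dividing a unit multiple of it modulo `(f, g)`. -/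
theorem of_congr (H : IsCoprimeRegularTriple f g h) (hf : IsRelPrime f h')
    (hg : IsRelPrime g h') {u v r s : R} (hu : IsUnit u) (e : v * h' = u * h + r * f + s * g) :
    IsCoprimeRegularTriple f g h' where
  isRelPrime₁₂ := H.isRelPrime₁₂
  isRelPrime₁₃ := hf
  isRelPrime₂₃ := hg
  mem_of_mul_mem p hp := by
    apply H.mem_of_mul_mem
    rw [← Ideal.unit_mul_mem_iff_mem _ hu]
    obtain ⟨x, y, hxy⟩ := Ideal.mem_span_pair.mp hp
    refine Ideal.mem_span_pair.mpr ⟨v * x - r * p, v * y - s * p, ?_⟩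
    linear_combination v * hxy + p * e

end CommRing

section UFD

variable {R : Type*} [CommRing R] [UniqueFactorizationMonoid R] {f g h h' : R}

theorem swap₂₃ (H : IsCoprimeRegularTriple f g h) : IsCoprimeRegularTriple f h g where
  isRelPrime₁₂ := H.isRelPrime₁₃
  isRelPrime₁₃ := H.isRelPrime₁₂
  isRelPrime₂₃ := H.isRelPrime₂₃.symm
  mem_of_mul_mem p hp := by
    obtain ⟨a, b, hab⟩ := Ideal.mem_span_pair.mp hp
    have hb : h * b ∈ Ideal.span {f, g} :=
      Ideal.mem_span_pair.mpr ⟨-a, p, by linear_combination -hab⟩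
    obtain ⟨s, t, hst⟩ := Ideal.mem_span_pair.mp (H.mem_of_mul_mem b hb)
    have hd : f ∣ g * (p - h * t) :=
      ⟨a + s * h, by linear_combination -hab - h * hst⟩
    obtain ⟨q, hq⟩ := H.isRelPrime₁₂.dvd_of_dvd_mul_left hd
    exact Ideal.mem_span_pair.mpr ⟨q, t, by linear_combination -hq⟩

theorem rotate (H : IsCoprimeRegularTriple f g h) : IsCoprimeRegularTriple g h f :=
  H.swap₁₂.swap₂₃

theorem mul₃ (H : IsCoprimeRegularTriple f g h) (H' : IsCoprimeRegularTriple f g h') :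
    IsCoprimeRegularTriple f g (h * h') where
  isRelPrime₁₂ := H.isRelPrime₁₂
  isRelPrime₁₃ := H.isRelPrime₁₃.mul_right H'.isRelPrime₁₃
  isRelPrime₂₃ := H.isRelPrime₂₃.mul_right H'.isRelPrime₂₃
  mem_of_mul_mem p hp := by
    rw [mul_assoc] at hp
    exact H'.mem_of_mul_mem _ (H.mem_of_mul_mem _ hp)

theorem sq₃ (H : IsCoprimeRegularTriple f g h) : IsCoprimeRegularTriple f g (h ^ 2) :=
  sq h ▸ H.mul₃ H

theorem isWeaklyRegular (H : IsCoprimeRegularTriple f g h) (hf : f ≠ 0) :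
    RingTheory.Sequence.IsWeaklyRegular R [f, g, h] := by
  refine ⟨fun i hi ↦ (isSMulRegular_quotient_iff_mem_of_smul_mem _ _).mpr fun p hp ↦ ?_⟩
  rw [smul_eq_mul, Ideal.mul_top] at hp ⊢
  match i, hi with
  | 0, _ => simpa [hf] using hp
  | 1, _ =>
    simp only [List.take_succ_cons, List.take_zero, Ideal.ofList_singleton,
      Ideal.mem_span_singleton] at hp ⊢
    exact H.isRelPrime₁₂.dvd_of_dvd_mul_left hp
  | 2, _ =>
    simp only [List.take_succ_cons, List.take_zero, Ideal.ofList_cons f [g],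
      Ideal.ofList_singleton, ← Ideal.span_insert] at hp ⊢
    exact H.mem_of_mul_mem p hp

end UFD

end IsCoprimeRegularTriple

section Quadrics

variable {F σ : Type*} [Field F]

theorem isRelPrime_of_irreducible_of_eval {p q : MvPolynomial σ F} (hp : Irreducible p)
    (w : σ → F) (hpw : eval w p = 0) (hqw : eval w q ≠ 0) : IsRelPrime p q := by
  refine hp.isRelPrime_iff_not_dvd.mpr fun ⟨r, hr⟩ ↦ hqw ?_
  rw [hr, map_mul, hpw, zero_mul]

theorem irreducible_X_add_C_mul_X {i j : σ} (hij : i ≠ j) (s : F) :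
    Irreducible (X i + C s * X j : MvPolynomial σ F) := by
  have := irreducible_mul_X_add (1 : MvPolynomial σ F) (C s * X j) i one_ne_zero (by simp)
    (fun h ↦ by
      classical
      have := vars_mul _ _ h
      simp_all) isRelPrime_one_left
  simpa using this

/-- The quadric `b Xᵢ² + a Xⱼ² + a Xₖ²`. -/
def quad (a b : F) (i j k : σ) : MvPolynomial σ F :=
  C b * X i ^ 2 + C a * X j ^ 2 + C a * X k ^ 2

theorem quad_swap (a b : F) (i j k : σ) : quad a b i j k = quad a b i k j := by
  simp only [quad]
  ring

variable {a b : F} {i j k : σ}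

theorem quad_ne_zero (hij : i ≠ j) (hik : i ≠ k) (hb : b ≠ 0) : quad a b i j k ≠ 0 := by
  classical
  intro h
  have := congrArg (eval (Pi.single i 1)) h
  simp [quad, hij.symm, hik.symm, hb] at this

theorem isRelPrime_X_X (hij : i ≠ j) : IsRelPrime (X i : MvPolynomial σ F) (X j) := by
  classical
  exact isRelPrime_of_irreducible_of_eval X_prime.irreducible (Pi.single j 1)
    (by simp [hij]) (by simp)

theorem isRelPrime_X_quad (hij : i ≠ j) (hjk : j ≠ k) (hb : b ≠ 0) :
    IsRelPrime (X i) (quad a b j k i) := by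
  classical
  exact isRelPrime_of_irreducible_of_eval X_prime.irreducible (Pi.single j 1)
    (by simp [hij]) (by simpa [quad, hij, hjk.symm])

theorem isRelPrime_quad_quad (hij : i ≠ j) (hjk : j ≠ k) (hik : i ≠ k) (hab : a + b ≠ 0)
    (hba : b - a ≠ 0) : IsRelPrime (quad a b i j k) (quad a b j k i) := by
  classical
  have key (s : F) (hs : s ^ 2 = 1) :
      IsRelPrime (X i + C s * X j : MvPolynomial σ F) (quad a b j k i) :=
    isRelPrime_of_irreducible_of_eval (irreducible_X_add_C_mul_X hij s)
      (Pi.single i (-s) + Pi.single j 1) (by simp [hij, hij.symm])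
      (by simpa [quad, hij, hij.symm, hjk.symm, hik.symm, hs, add_comm] using hab)
  intro d hd hd'
  have hu : IsUnit (C (b - a) : MvPolynomial σ F) := hba.isUnit.map C
  have hdvd : d ∣ (X i + C 1 * X j) * (X i + C (-1) * X j) := by
    rw [← hu.dvd_mul_left]
    convert dvd_sub hd hd' using 1
    simp only [quad, map_sub, map_neg, map_one]
    ring
  exact ((key 1 (by simp)).mul_left (key (-1) (by simp))) hdvd hd'

theorem isCoprimeRegularTriple_X (hij : i ≠ j) (hjk : j ≠ k) (hik : i ≠ k) :
    IsCoprimeRegularTriple (X i : MvPolynomial σ F) (X j) (X k) where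
  isRelPrime₁₂ := isRelPrime_X_X hij
  isRelPrime₁₃ := isRelPrime_X_X hik
  isRelPrime₂₃ := isRelPrime_X_X hjk
  mem_of_mul_mem p hp := by
    classical
    rw [← Set.image_pair, mem_ideal_span_X_image] at hp ⊢
    intro m hm
    obtain ⟨l, hl, h⟩ := hp (Finsupp.single k 1 + m) (by simpa [coeff_X_mul] using hm)
    refine ⟨l, hl, ?_⟩
    have hlk : l ≠ k := by
      rcases hl with rfl | rfl <;> assumption
    rwa [Finsupp.add_apply, Finsupp.single_eq_of_ne hlk, zero_add] at h

theorem isCoprimeRegularTriple_X_X_quad (hij : i ≠ j) (hjk : j ≠ k) (hik : i ≠ k) (hb : b ≠ 0) :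
    IsCoprimeRegularTriple (X i) (X j) (quad a b k i j) := by
  refine (isCoprimeRegularTriple_X hij hjk hik).sq₃.of_congr (u := C b) (v := 1)
    (r := C a * X i) (s := C a * X j) ?_ (isRelPrime_X_quad hjk hik.symm hb)
    (hb.isUnit.map C) ?_
  · rw [quad_swap]
    exact isRelPrime_X_quad hik hjk.symm hb
  · simp only [quad]
    ring

theorem isCoprimeRegularTriple_X_quad_quad (hij : i ≠ j) (hjk : j ≠ k) (hik : i ≠ k)
    (hb : b ≠ 0) (hab : a + b ≠ 0) (hba : b - a ≠ 0) :
    IsCoprimeRegularTriple (X i) (quad a b j k i) (quad a b k i j) := by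
  have h₁ : IsCoprimeRegularTriple (X i) (quad a b j k i) (X k) := by
    rw [← quad_swap]
    exact (isCoprimeRegularTriple_X_X_quad hik hjk.symm hij hb).swap₂₃
  refine h₁.sq₃.of_congr (u := C ((b - a) * (a + b))) (v := C b)
    (r := C (a * (b - a)) * X i) (s := C a) ?_ (isRelPrime_quad_quad hjk hik.symm hij.symm hab hba)
    ((mul_ne_zero hba hab).isUnit.map C) ?_
  · rw [quad_swap]
    exact isRelPrime_X_quad hik hjk.symm hb
  · simp only [quad, map_mul, map_sub, map_add]
    ring

theorem isCoprimeRegularTriple_quad (hij : i ≠ j) (hjk : j ≠ k) (hik : i ≠ k)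
    (hb : b ≠ 0) (hab : a + b ≠ 0) (hba : b - a ≠ 0) (h2ab : 2 * a + b ≠ 0) :
    IsCoprimeRegularTriple (quad a b i j k) (quad a b j k i) (quad a b k i j) := by
  have h₁ := (isCoprimeRegularTriple_X_quad_quad hik.symm hij hjk.symm hb hab hba).rotate
  refine h₁.sq₃.of_congr (u := C ((b - a) * (2 * a + b))) (v := C (a + b))
    (r := C a) (s := C a) (isRelPrime_quad_quad hik.symm hij hjk.symm hab hba).symm
    (isRelPrime_quad_quad hjk hik.symm hij.symm hab hba)
    ((mul_ne_zero hba h2ab).isUnit.map C) ?_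
  simp only [quad, map_mul, map_sub, map_add, map_ofNat]
  ring

theorem isCoprimeRegularTriple_X_mul_quad (hij : i ≠ j) (hjk : j ≠ k) (hik : i ≠ k)
    (hb : b ≠ 0) (hab : a + b ≠ 0) (hba : b - a ≠ 0) (h2ab : 2 * a + b ≠ 0) :
    IsCoprimeRegularTriple (X i * quad a b i j k) (X j * quad a b j k i)
      (X k * quad a b k i j) := by
  have hXXQ {i j k : σ} (hij : i ≠ j) (hjk : j ≠ k) (hik : i ≠ k) :=
    isCoprimeRegularTriple_X_X_quad (a := a) hij hjk hik hb
  have hXQQ {i j k : σ} (hij : i ≠ j) (hjk : j ≠ k) (hik : i ≠ k) :=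
    isCoprimeRegularTriple_X_quad_quad hij hjk hik hb hab hba
  have hXX : IsCoprimeRegularTriple (X i) (X j) (X k * quad a b k i j) :=
    (isCoprimeRegularTriple_X hij hjk hik).mul₃ (hXXQ hij hjk hik)
  have hXQ : IsCoprimeRegularTriple (X i) (quad a b j k i) (X k * quad a b k i j) :=
    (hXXQ hik.symm hij hjk.symm).rotate.mul₃ (hXQQ hij hjk hik)
  have hQX : IsCoprimeRegularTriple (quad a b i j k) (X j) (X k * quad a b k i j) :=
    (hXXQ hjk hik.symm hij.symm).rotate.rotate.mul₃ (hXQQ hjk hik.symm hij.symm).rotate.rotate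
  have hQQ : IsCoprimeRegularTriple (quad a b i j k) (quad a b j k i) (X k * quad a b k i j) :=
    (hXQQ hik.symm hij hjk.symm).rotate.mul₃
      (isCoprimeRegularTriple_quad hij hjk hik hb hab hba h2ab)
  exact ((hXX.swap₂₃.mul₃ hXQ.swap₂₃).rotate.mul₃
    (hQX.swap₂₃.mul₃ hQQ.swap₂₃).rotate).rotate.swap₁₂

end Quadrics

/-- The only common zero of the three cubics with coordinates in a domain is the origin. -/
theorem eq_zero_of_cubics_eq_zero {A : Type*} [CommRing A] [IsDomain A] {a b x y z : A}
    (hb : b ≠ 0) (hab : a + b ≠ 0) (hba : b - a ≠ 0) (h2ab : 2 * a + b ≠ 0)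
    (hz : z * (b * z ^ 2 + a * x ^ 2 + a * y ^ 2) = 0)
    (hx : x * (b * x ^ 2 + a * y ^ 2 + a * z ^ 2) = 0)
    (hy : y * (b * y ^ 2 + a * z ^ 2 + a * x ^ 2) = 0) : x = 0 ∧ y = 0 ∧ z = 0 := by
  have two {x y : A} (hx : x * (b * x ^ 2 + a * y ^ 2) = 0)
      (hy : y * (b * y ^ 2 + a * x ^ 2) = 0) : x = 0 ∧ y = 0 := by
    by_cases hx0 : x = 0
    · subst hx0
      simpa [hb] using hy
    by_cases hy0 : y = 0
    · subst hy0
      simpa [hb] using hx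
    refine absurd ?_ hx0
    have hx' := (mul_eq_zero_iff_left hx0).mp hx
    have hy' := (mul_eq_zero_iff_left hy0).mp hy
    have : (b - a) * (a + b) * x ^ 2 = 0 := by linear_combination b * hx' - a * hy'
    simpa [hab, hba] using this
  by_cases hx0 : x = 0
  · subst hx0
    have := two (x := y) (y := z) (by linear_combination hy) (by linear_combination hz)
    simpa using this
  by_cases hy0 : y = 0
  · subst hy0
    have := two (x := x) (y := z) (by linear_combination hx) (by linear_combination hz)
    simpa using this
  by_cases hz0 : z = 0
  · subst hz0
    have := two (x := x) (y := y) (by linear_combination hx) (by linear_combination hy)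
    simpa using this
  refine absurd ?_ hx0
  have hx' := (mul_eq_zero_iff_left hx0).mp hx
  have hy' := (mul_eq_zero_iff_left hy0).mp hy
  have hz' := (mul_eq_zero_iff_left hz0).mp hz
  have : (b - a) * (2 * a + b) * x ^ 2 = 0 := by
    linear_combination (a + b) * hx' - a * hy' - a * hz'
  simpa [h2ab, hba] using this

theorem map_X_eq_zero {F A : Type*} [Field F] [CommRing A] [IsDomain A] {a b : F}
    (hb : b ≠ 0) (hab : a + b ≠ 0) (hba : b - a ≠ 0) (h2ab : 2 * a + b ≠ 0)
    (φ : MvPolynomial (Fin 3) F →+* A) (hz : φ (X 2 * quad a b 2 0 1) = 0)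
    (hx : φ (X 0 * quad a b 0 1 2) = 0) (hy : φ (X 1 * quad a b 1 2 0) = 0) (i : Fin 3) :
    φ (X i) = 0 := by
  have hφ {u : F} (hu : u ≠ 0) : φ (C u) ≠ 0 := (map_ne_zero (φ.comp C)).mpr hu
  obtain ⟨h0, h1, h2⟩ := eq_zero_of_cubics_eq_zero (a := φ (C a)) (b := φ (C b))
    (hφ hb) (by simpa using hφ hab) (by simpa using hφ hba)
    (by simpa [map_ofNat] using hφ h2ab) (by simpa [quad] using hz) (by simpa [quad] using hx)
    (by simpa [quad] using hy)
  fin_cases i <;> assumption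

theorem quad_coefficients_ne_zero {F : Type*} [Field F] {c : F} (hc : c ^ 2 + c + 2 = 0)
    (h2 : ringChar F ≠ 2) (h7 : ringChar F ≠ 7) :
    2 * c - 10 ≠ 0 ∧ (15 * c + 21) + (2 * c - 10) ≠ 0 ∧ (2 * c - 10) - (15 * c + 21) ≠ 0 ∧
      2 * (15 * c + 21) + (2 * c - 10) ≠ 0 := by
  have h2' : (2 : F) ≠ 0 := Ring.two_ne_zero h2
  have h7' : (7 : F) ≠ 0 := fun h ↦ h7 <| by
    have h : ((7 : ℕ) : F) = 0 := by exact_mod_cast h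
    exact ((Nat.prime_seven.eq_one_or_self_of_dvd _ (ringChar.dvd h)).resolve_left
      CharP.ringChar_ne_one)
  refine ⟨fun h ↦ ?_, fun h ↦ ?_, fun h ↦ ?_, fun h ↦ ?_⟩
  · have : (2 : F) ^ 7 = 0 := by linear_combination 4 * hc - (2 * c + 12) * h
    exact pow_ne_zero _ h2' this
  · have : (2 : F) ^ 9 = 0 := by linear_combination 289 * hc - (17 * c + 6) * h
    exact pow_ne_zero _ h2' this
  · have : (2 : F) ^ 7 * 7 = 0 := by linear_combination 169 * hc + (13 * c - 18) * h
    exact mul_ne_zero (pow_ne_zero _ h2') h7' this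
  · have : (2 : F) ^ 6 = 0 := by linear_combination 32 * hc - c * h
    exact pow_ne_zero _ h2' this

theorem ker_constantCoeff_fin_three {R : Type*} [CommRing R] :
    RingHom.ker (constantCoeff (σ := Fin 3) (R := R)) = Ideal.span {X 0, X 1, X 2} := by
  have h : ({X 0, X 1, X 2} : Set (MvPolynomial (Fin 3) R)) = X '' {0, 1, 2} := by
    simp [Set.image_insert_eq]
  ext p
  rw [h, mem_ideal_span_X_image, RingHom.mem_ker, constantCoeff_eq, ← notMem_support_iff]
  constructor
  · intro hp m hm
    by_contra! hm0
    refine hp ?_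
    convert hm
    ext i
    fin_cases i <;> simp_all
  · intro hp h0
    simpa using hp 0 h0

/-- if `char F ∉ {2,7}` and `c² + c + 2 = 0`, the ideal
`(zD₃, xD₁, yD₂)` has radical `(x,y,z)`; equivalently the three cubics have no
common zero in `P²` over an algebraic closure, and they form a regular sequence. -/
theorem klein_Ds_regular_sequence {F : Type*} [Field F] (c : F)
    (hc : c ^ 2 + c + 2 = 0) (h2 : ringChar F ≠ 2) (h7 : ringChar F ≠ 7) :
    (Ideal.span {X 2 * D₃ c, X 0 * D₁ c, X 1 * D₂ c} :
        Ideal (MvPolynomial (Fin 3) F)).radical =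
      Ideal.span {X 0, X 1, X 2} ∧
    (∀ w : Fin 3 → AlgebraicClosure F, w ≠ 0 →
      ¬(aeval w (X 2 * D₃ c) = 0 ∧ aeval w (X 0 * D₁ c) = 0 ∧
          aeval w (X 1 * D₂ c) = 0)) ∧
    RingTheory.Sequence.IsRegular (MvPolynomial (Fin 3) F)
      [X 2 * D₃ c, X 0 * D₁ c, X 1 * D₂ c] := by
  obtain ⟨hb, hab, hba, h2ab⟩ := quad_coefficients_ne_zero hc h2 h7
  set b := 2 * c - 10 with hb_def
  set a := 15 * c + 21 with ha_def
  have hD₁ : D₁ c = quad a b 0 1 2 := by simp only [D₁, quad, ha_def, hb_def]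
  have hD₂ : D₂ c = quad a b 1 2 0 := by
    simp only [D₂, quad, ← ha_def, ← hb_def]
    ring
  have hD₃ : D₃ c = quad a b 2 0 1 := by
    simp only [D₃, quad, ← ha_def, ← hb_def]
    ring
  rw [hD₁, hD₂, hD₃]
  refine ⟨?_, ?_, ?_⟩
  · apply le_antisymm
    · rw [← ker_constantCoeff_fin_three]
      refine (RingHom.ker_isPrime _).radical_le_iff.mpr ?_
      simp [Ideal.span_le, Set.insert_subset_iff, RingHom.mem_ker]
    · rw [Ideal.radical_eq_sInf]
      refine le_sInf fun P ⟨hP, hPp⟩ ↦ ?_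
      have hI {p : MvPolynomial (Fin 3) F} (hp : p ∈ ({X 2 * quad a b 2 0 1,
          X 0 * quad a b 0 1 2, X 1 * quad a b 1 2 0} : Set (MvPolynomial (Fin 3) F))) :
          Ideal.Quotient.mk P p = 0 :=
        Ideal.Quotient.eq_zero_iff_mem.mpr (hP (Ideal.subset_span hp))
      have hX (i : Fin 3) : X i ∈ P := Ideal.Quotient.eq_zero_iff_mem.mp <|
        map_X_eq_zero hb hab hba h2ab _ (hI (by simp)) (hI (by simp)) (hI (by simp)) i
      simp [Ideal.span_le, Set.insert_subset_iff, hX]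
  · rintro w hw ⟨hz, hx, hy⟩
    refine hw (funext fun i ↦ ?_)
    simpa using map_X_eq_zero hb hab hba h2ab (aeval w).toRingHom hz hx hy i
  · have H := isCoprimeRegularTriple_X_mul_quad (F := F) (i := (2 : Fin 3)) (j := 0) (k := 1)
      (by decide) (by decide) (by decide) hb hab hba h2ab
    refine ⟨H.isWeaklyRegular ?_, ?_⟩
    · exact mul_ne_zero (X_ne_zero _) (quad_ne_zero (by decide) (by decide) hb)
    · rw [smul_eq_mul, Ideal.mul_top]
      intro h
      refine RingHom.ker_ne_top (constantCoeff (σ := Fin 3) (R := F)) (top_le_iff.mp ?_)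
      rw [h]
      simp [Ideal.ofList, Ideal.span_le, Set.subset_def, RingHom.mem_ker]

end
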